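/- Let α ∈ (1/2, 1) ∪ (1, ∞), let p ∈ Δ_n satisfy p[j] > 0 for all j, and assume Σ_{j=1}^n p[j] W(j)^α is positive definite. Define F(Q) := (Σ_{j=1}^n p[j] W(j)^α / Tr[W(j)^α Q^{1−α}])^{1/α} on positive definite matrices, let Q* be a positive definite matrix with F(Q*) = Q*, let Q_1 be positive definite, and set Q_{t+1} := F(Q_t) for t ≥ 1. Then for every T ≥ 1, d_T(Q_{T+1}^{1−α}, (Q*)^{1−α}) ≤ (|1−α|/α)^T · d_T(Q_1^{1−α}, (Q*)^{1−α}). -/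

import Mathlib

open Matrix
open scoped ComplexOrder

/-- Matrix power of a Hermitian matrix, defined by applying `t ↦ t ^ r` (real `rpow`)
to the eigenvalues in a spectral decomposition. Returns `0` on non-Hermitian input. -/
noncomputable def matRpow {d : ℕ} (A : Matrix (Fin d) (Fin d) ℂ) (r : ℝ) :
    Matrix (Fin d) (Fin d) ℂ :=
  if hA : A.IsHermitian then
    (hA.eigenvectorUnitary : Matrix (Fin d) (Fin d) ℂ) *
      Matrix.diagonal (fun i => ((hA.eigenvalues i ^ r : ℝ) : ℂ)) *
      (star hA.eigenvectorUnitary : Matrix (Fin d) (Fin d) ℂ)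
  else 0

/-- Loewner order: `A ⪯ B` iff `B - A` is positive semidefinite. -/
def loewnerLE {d : ℕ} (A B : Matrix (Fin d) (Fin d) ℂ) : Prop := (B - A).PosSemidef

/-- Thompson metric on positive definite matrices. -/
noncomputable def thompsonDist {d : ℕ} (V U : Matrix (Fin d) (Fin d) ℂ) : ℝ :=
  sInf {r : ℝ | 0 ≤ r ∧ loewnerLE (Real.exp (-r) • V) U ∧ loewnerLE U (Real.exp r • V)}

/-- The fixed-point map `F(Q) = (∑ⱼ p[j] W(j)^α / Tr[W(j)^α Q^{1-α}])^{1/α}`. -/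
noncomputable def augFixedPointMap {n d : ℕ} (α : ℝ) (W : Fin n → Matrix (Fin d) (Fin d) ℂ)
    (p : Fin n → ℝ) (Q : Matrix (Fin d) (Fin d) ℂ) : Matrix (Fin d) (Fin d) ℂ :=
  matRpow (∑ j, (p j / ((matRpow (W j) α * matRpow Q (1 - α)).trace).re) • matRpow (W j) α)
    (1 / α)

section Helpers

open scoped MatrixOrder Matrix.Norms.L2Operator

variable {d : ℕ}

theorem matRpow_eq {A : Matrix (Fin d) (Fin d) ℂ} (hA : A.PosSemidef) (r : ℝ) :
    matRpow A r = A ^ r := by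
  have hA' : 0 ≤ A := Matrix.nonneg_iff_posSemidef.mpr hA
  rw [CFC.rpow_eq_cfc_real hA', hA.isHermitian.cfc_eq]
  rw [matRpow, dif_pos hA.isHermitian, Matrix.IsHermitian.cfc, Unitary.conjStarAlgAut_apply]
  rfl

theorem smul_rpow_aux {A : Matrix (Fin d) (Fin d) ℂ} (hA : 0 ≤ A) {c : ℝ} (hc : 0 ≤ c) (r : ℝ) :
    (c • A) ^ r = c ^ r • A ^ r := by
  have hcA : 0 ≤ c • A := smul_nonneg hc hA
  have hsa : IsSelfAdjoint A := IsSelfAdjoint.of_nonneg hA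
  have hfin : (spectrum ℝ A).Finite := Matrix.finite_real_spectrum
  rw [CFC.rpow_eq_cfc_real hA, CFC.rpow_eq_cfc_real hcA,
    ← cfc_comp_smul c (fun x : ℝ => x ^ r) A ((hfin.image _).continuousOn _) hsa,
    ← cfc_smul _ _ _ (hfin.continuousOn _)]
  refine cfc_congr fun x hx => ?_
  have hx0 : 0 ≤ x := spectrum_nonneg_of_nonneg hA hx
  simp [Real.mul_rpow hc hx0]

theorem inv_mono_aux {A B : Matrix (Fin d) (Fin d) ℂ} (hA : A.PosDef) (hAB : A ≤ B) :
    B ^ (-1 : ℝ) ≤ A ^ (-1 : ℝ) :=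
  CStarAlgebra.rpow_neg_one_le_rpow_neg_one hAB (Matrix.isStrictlyPositive_iff_posDef.mpr hA)

theorem rpow_posDef {A : Matrix (Fin d) (Fin d) ℂ} (hA : A.PosDef) (r : ℝ) :
    (A ^ r).PosDef :=
  Matrix.isStrictlyPositive_iff_posDef.mp
    (IsStrictlyPositive.rpow A r (Matrix.isStrictlyPositive_iff_posDef.mpr hA))

theorem rpow_rpow_aux {A : Matrix (Fin d) (Fin d) ℂ} (hA : A.PosDef) (x y : ℝ) (hx : x ≠ 0) :
    (A ^ x) ^ y = A ^ (x * y) :=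
  CFC.rpow_rpow A x y hx (Matrix.isStrictlyPositive_iff_posDef.mpr hA)

theorem smul_posDef {A : Matrix (Fin d) (Fin d) ℂ} (hA : A.PosDef) {c : ℝ} (hc : 0 < c) :
    (c • A).PosDef := hA.smul hc

theorem rpow_bounds_pos {A B : Matrix (Fin d) (Fin d) ℂ} (hA : A.PosDef) (hB : B.PosDef)
    {r s : ℝ} (hs : s ∈ Set.Icc (0 : ℝ) 1)
    (h1 : Real.exp (-r) • A ≤ B) (h2 : B ≤ Real.exp r • A) :
    Real.exp (-(s * r)) • A ^ s ≤ B ^ s ∧ B ^ s ≤ Real.exp (s * r) • A ^ s := by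
  have hA0 : 0 ≤ A := Matrix.nonneg_iff_posSemidef.mpr hA.posSemidef
  have k1 := CFC.rpow_le_rpow hs h1
  have k2 := CFC.rpow_le_rpow hs h2
  rw [smul_rpow_aux hA0 (Real.exp_pos _).le, ← Real.exp_mul] at k1 k2
  constructor
  · convert k1 using 3; ring
  · convert k2 using 3; ring

theorem inv_bounds {A B : Matrix (Fin d) (Fin d) ℂ} (hA : A.PosDef) (hB : B.PosDef)
    {r : ℝ} (h1 : Real.exp (-r) • A ≤ B) (h2 : B ≤ Real.exp r • A) :
    Real.exp (-r) • A ^ (-1 : ℝ) ≤ B ^ (-1 : ℝ) ∧ B ^ (-1 : ℝ) ≤ Real.exp r • A ^ (-1 : ℝ) := by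
  have hA0 : 0 ≤ A := Matrix.nonneg_iff_posSemidef.mpr hA.posSemidef
  have k1 := inv_mono_aux (smul_posDef hA (Real.exp_pos _)) h1
  have k2 := inv_mono_aux hB h2
  rw [smul_rpow_aux hA0 (Real.exp_pos _).le, ← Real.exp_mul] at k1 k2
  constructor
  · convert k2 using 3; ring
  · convert k1 using 3; ring

theorem rpow_bounds {A B : Matrix (Fin d) (Fin d) ℂ} (hA : A.PosDef) (hB : B.PosDef)
    {r s : ℝ} (hs0 : s ≠ 0) (hs : |s| ≤ 1)
    (h1 : Real.exp (-r) • A ≤ B) (h2 : B ≤ Real.exp r • A) :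
    Real.exp (-(|s| * r)) • A ^ s ≤ B ^ s ∧ B ^ s ≤ Real.exp (|s| * r) • A ^ s := by
  have k := rpow_bounds_pos hA hB ⟨abs_nonneg s, hs⟩ h1 h2
  rcases lt_or_gt_of_ne hs0 with h | h
  · have k' := inv_bounds (rpow_posDef hA _) (rpow_posDef hB _) k.1 k.2
    have e : |s| * (-1) = s := by rw [abs_of_neg h]; ring
    rw [rpow_rpow_aux hA _ _ (abs_pos.mpr hs0).ne', rpow_rpow_aux hB _ _ (abs_pos.mpr hs0).ne',
      e] at k'
    exact k'
  · rw [abs_of_pos h] at k ⊢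
    exact k

theorem trace_mul_nonneg {A B : Matrix (Fin d) (Fin d) ℂ} (hA : 0 ≤ A) (hB : 0 ≤ B) :
    0 ≤ (A * B).trace.re := by
  obtain ⟨C, rfl⟩ := CStarAlgebra.nonneg_iff_eq_star_mul_self.mp hA
  rw [mul_assoc, Matrix.trace_mul_comm]
  have := (Matrix.nonneg_iff_posSemidef.mp hB).mul_mul_conjTranspose_same C
  exact (Complex.le_def.mp this.trace_nonneg).1

theorem trace_mul_mono {A B C : Matrix (Fin d) (Fin d) ℂ} (hA : 0 ≤ A) (hB : B ≤ C) :
    (A * B).trace.re ≤ (A * C).trace.re := by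
  have := trace_mul_nonneg hA (sub_nonneg.mpr hB)
  rw [mul_sub, Matrix.trace_sub, Complex.sub_re] at this
  linarith

theorem trace_mul_smul (A B : Matrix (Fin d) (Fin d) ℂ) (c : ℝ) :
    (A * (c • B)).trace.re = c * (A * B).trace.re := by
  rw [mul_smul_comm, Matrix.trace_smul, Complex.real_smul, Complex.re_ofReal_mul]

theorem le_smul_exists {A B : Matrix (Fin d) (Fin d) ℂ} (hA : A.PosDef) (hB : B.PosDef) :
    ∃ c : ℝ, 0 < c ∧ c • A ≤ B := by
  have hA0 : 0 ≤ A := Matrix.nonneg_iff_posSemidef.mpr hA.posSemidef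
  have hBi := rpow_posDef hB (-1)
  have hB0 : 0 ≤ B := Matrix.nonneg_iff_posSemidef.mpr hB.posSemidef
  have hBi0 : 0 ≤ B ^ (-1 : ℝ) := Matrix.nonneg_iff_posSemidef.mpr hBi.posSemidef
  have h1 : B ^ (-1 : ℝ) ≤ (‖B ^ (-1 : ℝ)‖ + 1) • (1 : Matrix (Fin d) (Fin d) ℂ) := by
    have h : B ^ (-1 : ℝ) ≤ algebraMap ℝ _ ‖B ^ (-1 : ℝ)‖ :=
      IsSelfAdjoint.le_algebraMap_norm_self (.of_nonneg hBi0)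
    rw [Algebra.algebraMap_eq_smul_one] at h
    exact h.trans (smul_le_smul_of_nonneg_right (by linarith) zero_le_one)
  have h2 : A ≤ ‖A‖ • (1 : Matrix (Fin d) (Fin d) ℂ) := by
    rw [← Algebra.algebraMap_eq_smul_one]
    exact IsSelfAdjoint.le_algebraMap_norm_self (.of_nonneg hA0)
  set M := ‖B ^ (-1 : ℝ)‖ + 1 with hM
  have hMpos : 0 < M := by positivity
  have h3 := inv_mono_aux hBi h1
  rw [smul_rpow_aux zero_le_one hMpos.le, CFC.one_rpow, rpow_rpow_aux hB _ _ (by norm_num),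
    neg_one_mul, neg_neg, CFC.rpow_one B hB0, Real.rpow_neg_one] at h3
  refine ⟨M⁻¹ / (‖A‖ + 1), by positivity, le_trans ?_ h3⟩
  refine (smul_le_smul_of_nonneg_left h2 (by positivity)).trans ?_
  rw [smul_smul]
  refine smul_le_smul_of_nonneg_right ?_ zero_le_one
  rw [div_mul_eq_mul_div, div_le_iff₀ (by positivity)]
  have : 0 < M⁻¹ := by positivity
  nlinarith [norm_nonneg A]

theorem trace_mul_pos {K V : Matrix (Fin d) (Fin d) ℂ} (hK : 0 ≤ K) (hK0 : K ≠ 0)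
    (hV : V.PosDef) : 0 < (K * V).trace.re := by
  obtain ⟨c, hc, h⟩ := le_smul_exists Matrix.PosDef.one hV
  have hKp := Matrix.nonneg_iff_posSemidef.mp hK
  have h1 := trace_mul_mono hK h
  rw [trace_mul_smul, mul_one] at h1
  have h2 := Complex.le_def.mp hKp.trace_nonneg
  have h3 : K.trace.re ≠ 0 := by
    intro h0
    apply hK0
    rw [← hKp.trace_eq_zero_iff]
    exact Complex.ext h0 h2.2.symm
  have h4 : 0 < K.trace.re := lt_of_le_of_ne h2.1 (Ne.symm h3)
  have : 0 < c * K.trace.re := by positivity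
  linarith

theorem thompson_set_nonempty {V U : Matrix (Fin d) (Fin d) ℂ} (hV : V.PosDef) (hU : U.PosDef) :
    {r : ℝ | 0 ≤ r ∧ loewnerLE (Real.exp (-r) • V) U ∧
      loewnerLE U (Real.exp r • V)}.Nonempty := by
  obtain ⟨a, ha, h1⟩ := le_smul_exists hV hU
  obtain ⟨b, hb, h2⟩ := le_smul_exists hU hV
  have hV0 : 0 ≤ V := Matrix.nonneg_iff_posSemidef.mpr hV.posSemidef
  have h2' : U ≤ b⁻¹ • V := by
    have := smul_le_smul_of_nonneg_left h2 (inv_pos.mpr hb).le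
    rwa [smul_smul, inv_mul_cancel₀ hb.ne', one_smul] at this
  refine ⟨|Real.log a| + |Real.log b|, by positivity, ?_, ?_⟩
  · refine le_trans (smul_le_smul_of_nonneg_right ?_ hV0) h1
    rw [← Real.le_log_iff_exp_le ha]
    have := neg_abs_le (Real.log a)
    have := abs_nonneg (Real.log b)
    linarith
  · refine le_trans h2' (smul_le_smul_of_nonneg_right ?_ hV0)
    rw [← Real.log_le_iff_le_exp (inv_pos.mpr hb), Real.log_inv]
    have := neg_abs_le (Real.log b)
    have := abs_nonneg (Real.log a)
    linarith

/-- The map `V ↦ ∑ⱼ p[j] K(j) / Tr[K(j) V]`. -/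
noncomputable def sumMap {n : ℕ} (p : Fin n → ℝ) (K : Fin n → Matrix (Fin d) (Fin d) ℂ)
    (V : Matrix (Fin d) (Fin d) ℂ) : Matrix (Fin d) (Fin d) ℂ :=
  ∑ j, (p j / ((K j * V).trace).re) • K j

theorem sumMap_le {n : ℕ} {p : Fin n → ℝ} {K : Fin n → Matrix (Fin d) (Fin d) ℂ}
    (hp : ∀ j, 0 < p j) (hK : ∀ j, 0 ≤ K j) (hK0 : ∀ j, K j ≠ 0)
    {V U : Matrix (Fin d) (Fin d) ℂ} (hV : V.PosDef) (hU : U.PosDef) {c : ℝ} (hc : 0 < c)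
    (h : V ≤ c • U) : sumMap p K U ≤ c • sumMap p K V := by
  unfold sumMap
  rw [Finset.smul_sum]
  refine Finset.sum_le_sum fun j _ => ?_
  rw [smul_smul]
  refine smul_le_smul_of_nonneg_right ?_ (hK j)
  have h1 := trace_mul_mono (hK j) h
  rw [trace_mul_smul] at h1
  have hv := trace_mul_pos (hK j) (hK0 j) hV
  have hu := trace_mul_pos (hK j) (hK0 j) hU
  rw [mul_div_assoc', div_le_div_iff₀ hu hv]
  nlinarith [hp j]

theorem sumMap_posDef {n : ℕ} {p : Fin n → ℝ} {K : Fin n → Matrix (Fin d) (Fin d) ℂ}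
    (hp : ∀ j, 0 < p j) (hK : ∀ j, 0 ≤ K j) (hK0 : ∀ j, K j ≠ 0)
    (hP : (∑ j, p j • K j).PosDef)
    {V : Matrix (Fin d) (Fin d) ℂ} (hV : V.PosDef) : (sumMap p K V).PosDef := by
  have ht : ∀ j, 0 < (K j * V).trace.re := fun j => trace_mul_pos (hK j) (hK0 j) hV
  set ε : ℝ := (1 + ∑ j, (K j * V).trace.re)⁻¹ with hε
  have hs : 0 ≤ ∑ j, (K j * V).trace.re := Finset.sum_nonneg fun j _ => (ht j).le
  have hεp : 0 < ε := by positivity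
  have hle : ε • (∑ j, p j • K j) ≤ sumMap p K V := by
    unfold sumMap
    rw [Finset.smul_sum]
    refine Finset.sum_le_sum fun j _ => ?_
    rw [smul_smul]
    refine smul_le_smul_of_nonneg_right ?_ (hK j)
    rw [mul_comm, div_eq_mul_inv]
    refine mul_le_mul_of_nonneg_left ?_ (hp j).le
    refine inv_anti₀ (ht j) ?_
    have := Finset.single_le_sum (f := fun j => (K j * V).trace.re)
      (fun j _ => (ht j).le) (Finset.mem_univ j)
    linarith
  have := (smul_posDef hP hεp).add_posSemidef (Matrix.le_iff.mp hle)
  rwa [add_sub_cancel] at this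

theorem rpow_ne_zero_aux {A : Matrix (Fin d) (Fin d) ℂ} (hA : 0 ≤ A) (hA0 : A ≠ 0) {α : ℝ}
    (hα : 0 < α) : A ^ α ≠ 0 := by
  intro h
  apply hA0
  have h1 := CFC.rpow_rpow_of_exponent_nonneg A α (1 / α) hα.le (by positivity) hA
  rw [h, mul_one_div_cancel hα.ne', CFC.rpow_one A hA] at h1
  rw [← h1]
  exact CFC.zero_rpow (by positivity)

/-- One-step contraction. -/
theorem thompson_step {n : ℕ} {p : Fin n → ℝ} {K : Fin n → Matrix (Fin d) (Fin d) ℂ}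
    (hp : ∀ j, 0 < p j) (hK : ∀ j, 0 ≤ K j) (hK0 : ∀ j, K j ≠ 0)
    (hP : (∑ j, p j • K j).PosDef)
    {V U : Matrix (Fin d) (Fin d) ℂ} (hV : V.PosDef) (hU : U.PosDef) {s : ℝ} (hs0 : s ≠ 0)
    (hs : |s| ≤ 1) :
    thompsonDist (sumMap p K V ^ s) (sumMap p K U ^ s) ≤ |s| * thompsonDist V U := by
  have hsp : 0 < |s| := abs_pos.mpr hs0
  rw [← div_le_iff₀' hsp]
  refine le_csInf (thompson_set_nonempty hV hU) ?_
  rintro r ⟨hr, h1, h2⟩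
  rw [div_le_iff₀' hsp]
  refine csInf_le ⟨0, fun x hx => hx.1⟩ ?_
  replace h1 : Real.exp (-r) • V ≤ U := h1
  replace h2 : U ≤ Real.exp r • V := h2
  have h1' : V ≤ Real.exp r • U := by
    have := smul_le_smul_of_nonneg_left h1 (Real.exp_pos r).le
    rwa [smul_smul, ← Real.exp_add, add_neg_cancel, Real.exp_zero, one_smul] at this
  have k1 := sumMap_le hp hK hK0 hV hU (Real.exp_pos r) h1'
  have k2 := sumMap_le hp hK hK0 hU hV (Real.exp_pos r) h2
  have k2' : Real.exp (-r) • sumMap p K V ≤ sumMap p K U := by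
    have := smul_le_smul_of_nonneg_left k2 (Real.exp_pos (-r)).le
    rwa [smul_smul, ← Real.exp_add, neg_add_cancel, Real.exp_zero, one_smul] at this
  have k := rpow_bounds (sumMap_posDef hp hK hK0 hP hV) (sumMap_posDef hp hK hK0 hP hU) hs0 hs
    k2' k1
  exact ⟨by positivity, k.1, k.2⟩

theorem map_facts {n : ℕ} {α : ℝ} (hα : 0 < α)
    {W : Fin n → Matrix (Fin d) (Fin d) ℂ} {p : Fin n → ℝ}
    (hp : ∀ j, 0 < p j) (hK : ∀ j, 0 ≤ matRpow (W j) α) (hK0 : ∀ j, matRpow (W j) α ≠ 0)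
    (hP : (∑ j, p j • matRpow (W j) α).PosDef)
    {Q : Matrix (Fin d) (Fin d) ℂ} (hQ : Q.PosDef) :
    (augFixedPointMap α W p Q).PosDef ∧
    matRpow (augFixedPointMap α W p Q) (1 - α) =
      sumMap p (fun j => matRpow (W j) α) (matRpow Q (1 - α)) ^ ((1 - α) / α) := by
  have hV : (matRpow Q (1 - α)).PosDef := by
    rw [matRpow_eq hQ.posSemidef]; exact rpow_posDef hQ _
  have hS := sumMap_posDef hp hK hK0 hP hV
  have e : augFixedPointMap α W p Q =
      sumMap p (fun j => matRpow (W j) α) (matRpow Q (1 - α)) ^ (1 / α) :=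
    matRpow_eq hS.posSemidef _
  have hF : (augFixedPointMap α W p Q).PosDef := by rw [e]; exact rpow_posDef hS _
  refine ⟨hF, ?_⟩
  rw [matRpow_eq hF.posSemidef, e, rpow_rpow_aux hS _ _ (by positivity)]
  congr 1
  ring

theorem main_aux {n : ℕ} (α : ℝ)
    (hα : α ∈ Set.Ioo (1 / 2 : ℝ) 1 ∪ Set.Ioi (1 : ℝ))
    (W : Fin n → Matrix (Fin d) (Fin d) ℂ)
    (hW : ∀ j, (W j).PosSemidef ∧ (W j).trace = 1)
    (p : Fin n → ℝ) (hppos : ∀ j, 0 < p j)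
    (hPD : (∑ j, p j • matRpow (W j) α).PosDef)
    (Qstar : Matrix (Fin d) (Fin d) ℂ) (hQstar : Qstar.PosDef)
    (hfix : augFixedPointMap α W p Qstar = Qstar)
    (Q : ℕ → Matrix (Fin d) (Fin d) ℂ) (hQ1 : (Q 1).PosDef)
    (hiter : ∀ t, 1 ≤ t → Q (t + 1) = augFixedPointMap α W p (Q t))
    (T : ℕ) :
    (Q (T + 1)).PosDef ∧
    thompsonDist (matRpow (Q (T + 1)) (1 - α)) (matRpow Qstar (1 - α))
      ≤ (|1 - α| / α) ^ T * thompsonDist (matRpow (Q 1) (1 - α)) (matRpow Qstar (1 - α)) := by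
  have hα0 : 0 < α := by rcases hα with h | h <;> have := h <;> simp at this <;> linarith
  have hα1 : 1 - α ≠ 0 := by
    rcases hα with h | h
    · have := h.2; intro h; linarith
    · have : 1 < α := h
      intro h; linarith
  have hs : |(1 - α) / α| = |1 - α| / α := by rw [abs_div, abs_of_pos hα0]
  have hs1 : |(1 - α) / α| ≤ 1 := by
    rw [hs, div_le_one hα0, abs_le]
    rcases hα with h | h
    · have := h.1; constructor <;> linarith
    · have : 1 < α := h
      constructor <;> linarith
  have hs0 : (1 - α) / α ≠ 0 := div_ne_zero hα1 hα0.ne'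
  have hK : ∀ j, 0 ≤ matRpow (W j) α := fun j => by
    rw [matRpow_eq (hW j).1]; exact CFC.rpow_nonneg
  have hK0 : ∀ j, matRpow (W j) α ≠ 0 := fun j => by
    rw [matRpow_eq (hW j).1]
    refine rpow_ne_zero_aux (Matrix.nonneg_iff_posSemidef.mpr (hW j).1) ?_ hα0
    intro h
    have := (hW j).2
    rw [h, Matrix.trace_zero] at this
    exact zero_ne_one this
  have hpow : ∀ {A : Matrix (Fin d) (Fin d) ℂ}, A.PosDef → (matRpow A (1 - α)).PosDef :=
    fun {A} hA => by rw [matRpow_eq hA.posSemidef]; exact rpow_posDef hA _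
  induction T with
  | zero => exact ⟨hQ1, by simp⟩
  | succ T ih =>
    obtain ⟨hQ, ih⟩ := ih
    have f1 := map_facts hα0 hppos hK hK0 hPD hQ
    have f2 := map_facts hα0 hppos hK hK0 hPD hQstar
    rw [hfix] at f2
    rw [← hiter (T + 1) (by omega)] at f1
    refine ⟨f1.1, ?_⟩
    have st := thompson_step hppos hK hK0 hPD (hpow hQ) (hpow hQstar) hs0 hs1
    rw [← f1.2, ← f2.2, hs] at st
    refine st.trans ?_
    rw [pow_succ', mul_assoc]
    exact mul_le_mul_of_nonneg_left ih (by positivity)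

end Helpers

/-- linear convergence of the fixed-point iteration with respect to the
Thompson metric. -/
theorem aug_fixed_point_linear_convergence {n d : ℕ} (hn : 0 < n) (hd : 0 < d) (α : ℝ)
    (hα : α ∈ Set.Ioo (1 / 2 : ℝ) 1 ∪ Set.Ioi (1 : ℝ))
    (W : Fin n → Matrix (Fin d) (Fin d) ℂ)
    (hW : ∀ j, (W j).PosSemidef ∧ (W j).trace = 1)
    (p : Fin n → ℝ) (hp : p ∈ stdSimplex ℝ (Fin n)) (hppos : ∀ j, 0 < p j)
    (hPD : (∑ j, p j • matRpow (W j) α).PosDef)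
    (Qstar : Matrix (Fin d) (Fin d) ℂ) (hQstar : Qstar.PosDef)
    (hfix : augFixedPointMap α W p Qstar = Qstar)
    (Q : ℕ → Matrix (Fin d) (Fin d) ℂ) (hQ1 : (Q 1).PosDef)
    (hiter : ∀ t, 1 ≤ t → Q (t + 1) = augFixedPointMap α W p (Q t))
    (T : ℕ) (hT : 1 ≤ T) :
    thompsonDist (matRpow (Q (T + 1)) (1 - α)) (matRpow Qstar (1 - α))
      ≤ (|1 - α| / α) ^ T * thompsonDist (matRpow (Q 1) (1 - α)) (matRpow Qstar (1 - α)) := by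
  exact (main_aux α hα W hW p hppos hPD Qstar hQstar hfix Q hQ1 hiter T).2
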